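/- Suppose n > 2 and a, b, c, d ∈ ℂ[X] are nonconstant with a ∘ b = c ∘ d and gcd(deg a, deg c) = gcd(deg b, deg d) = 1. If c = T_n, then with m := deg d there exist linear ℓ, ℓ̂ ∈ ℂ[X] and ε ∈ {1, −1} such that d = ε·T_m ∘ ℓ, a = ε^n·T_m ∘ ℓ̂, and b = ℓ̂^{-1} ∘ T_n ∘ ℓ. If instead d = T_n, then with m := deg c there exist linear ℓ, ℓ̂ ∈ ℂ[X] and ε ∈ {1, −1} such that a = ℓ ∘ T_n ∘ ℓ̂, b = ℓ̂^{-1} ∘ ε·T_m, and c = ℓ ∘ ε^n·T_m. -/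

import Mathlib

open Polynomial

/-- The normalized degree-`n` Chebyshev polynomial `T_n`, characterized by
`T_n(Y + 1/Y) = Y^n + 1/Y^n`; it is the Dickson polynomial `D_n(X, 1)`
of the first kind. -/
noncomputable def chebT (n : ℕ) : ℂ[X] :=
  Polynomial.dickson 1 (1 : ℂ) n

theorem chebT_eq_chebyshev_C (n : ℕ) : chebT n = Chebyshev.C ℂ n :=
  dickson_one_one_eq_chebyshev_C ℂ n

theorem derivative_chebyshev_C (n : ℤ) :
    derivative (Chebyshev.C ℂ n) = (n : ℂ[X]) * Chebyshev.S ℂ (n - 1) := by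
  have h := congrArg derivative (Chebyshev.C_comp_two_mul_X ℂ n)
  have h2 : derivative (2 * X : ℂ[X]) = 2 := by simp
  have h3 : derivative (2 * Chebyshev.T ℂ n) = 2 * derivative (Chebyshev.T ℂ n) := by simp
  rw [derivative_comp, h2, h3, Chebyshev.T_derivative_eq_U, ← Chebyshev.S_comp_two_mul_X] at h
  have h4 := mul_left_cancel₀ (two_ne_zero) h
  have h5 : ((derivative (Chebyshev.C ℂ n) - (n : ℂ[X]) * Chebyshev.S ℂ (n - 1)).comp
      (2 * X)) = 0 := by
    rw [sub_comp, mul_comp, h4]; simp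
  rcases comp_eq_zero_iff.mp h5 with h6 | h6
  · exact sub_eq_zero.mp h6
  · have := congrArg (fun p => p.coeff 1) h6.2
    simp at this

/-- The first-order differential equation of the Chebyshev polynomials. -/
theorem chebT_ode (n : ℕ) :
    (X ^ 2 - 4) * derivative (chebT n) ^ 2 = C ((n : ℂ) ^ 2) * (chebT n ^ 2 - 4) := by
  have h1 := Chebyshev.S_sq_add_S_sq ℂ ((n : ℤ) - 1)
  have h2 := Chebyshev.C_eq_S_sub_X_mul_S ℂ (n : ℤ)
  rw [sub_add_cancel] at h1
  rw [chebT_eq_chebyshev_C, derivative_chebyshev_C, h2]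
  simp only [Int.cast_natCast, map_pow, map_natCast]
  linear_combination (-4 * (n : ℂ[X]) ^ 2) * h1

theorem chebT_eval_two (n : ℕ) : (chebT n).eval 2 = 2 := by
  rw [chebT_eq_chebyshev_C, Chebyshev.C_eval_two]

theorem chebT_eval_neg_two (n : ℕ) : (chebT n).eval (-2) = 2 * (-1) ^ n := by
  rw [chebT_eq_chebyshev_C, Chebyshev.C_eval_neg_two]
  simp

theorem chebT_comp_comm (m n : ℕ) : (chebT m).comp (chebT n) = (chebT n).comp (chebT m) :=
  dickson_one_one_comp_comm ℂ m n

theorem chebT_monic_natDegree (n : ℕ) :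
    (chebT (n + 1)).Monic ∧ (chebT (n + 1)).natDegree = n + 1 := by
  induction n using Nat.strong_induction_on with
  | _ n ih =>
    match n with
    | 0 => simp [chebT, monic_X]
    | 1 =>
      have : chebT 2 = X ^ 2 - C 2 := by
        have h2 : (C 2 : ℂ[X]) = 2 := rfl
        simp only [chebT, dickson_two, h2, map_one]
        push_cast
        ring
      rw [this]
      exact ⟨monic_X_pow_sub_C _ (by norm_num), natDegree_X_pow_sub_C⟩
    | k + 2 =>
      have h1 := ih (k + 1) (by omega)
      have h0 := ih k (by omega)
      have hrec : chebT (k + 2 + 1) = X * chebT (k + 1 + 1) - chebT (k + 1) := by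
        simp [chebT, dickson_add_two]
      have hm : (X * chebT (k + 1 + 1)).Monic := monic_X.mul h1.1
      have hd : (X * chebT (k + 1 + 1)).natDegree = k + 2 + 1 := by
        rw [natDegree_X_mul h1.1.ne_zero, h1.2]
      have hlt : (chebT (k + 1)).natDegree < (X * chebT (k + 1 + 1)).natDegree := by
        rw [hd, h0.2]; omega
      rw [hrec]
      exact ⟨hm.sub_of_left (degree_lt_degree hlt), by
        rw [natDegree_sub_eq_left_of_natDegree_lt hlt, hd]⟩

theorem chebT_monic {n : ℕ} (hn : 0 < n) : (chebT n).Monic := by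
  obtain ⟨k, rfl⟩ := Nat.exists_eq_add_of_lt hn
  simpa using (chebT_monic_natDegree k).1

theorem natDegree_chebT {n : ℕ} (hn : 0 < n) : (chebT n).natDegree = n := by
  obtain ⟨k, rfl⟩ := Nat.exists_eq_add_of_lt hn
  simpa using (chebT_monic_natDegree k).2

theorem chebT_comp_neg_X (n : ℕ) : (chebT n).comp (-X) = C ((-1) ^ n) * chebT n := by
  induction n using Nat.strong_induction_on with
  | _ n ih =>
    match n with
    | 0 =>
      have h : chebT 0 = C 2 := by
        have h2 : (C 2 : ℂ[X]) = 2 := rfl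
        simp only [chebT, dickson_zero, h2]
        push_cast
        ring
      simp [h]
    | 1 => simp [chebT]
    | k + 2 =>
      have hrec : chebT (k + 2) = X * chebT (k + 1) - chebT k := by
        simp [chebT, dickson_add_two]
      rw [hrec, sub_comp, mul_comp, ih (k + 1) (by omega), ih k (by omega), X_comp]
      simp only [pow_succ, map_mul, map_neg, map_one]
      ring

theorem chebT_comp_C_mul {ε : ℂ} (hε : ε = 1 ∨ ε = -1) (n : ℕ) (p : ℂ[X]) :
    (chebT n).comp (C ε * p) = C (ε ^ n) * (chebT n).comp p := by
  rcases hε with rfl | rfl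
  · simp
  · have : C (-1) * p = (-X : ℂ[X]).comp p := by simp
    rw [this, ← comp_assoc, chebT_comp_neg_X, mul_comp, C_comp]

theorem second_order_of_ode {P : ℂ[X]} {κ : ℂ} (hP : 0 < P.natDegree)
    (h : (X ^ 2 - 4) * derivative P ^ 2 = C κ * (P ^ 2 - 4)) :
    X * derivative P + (X ^ 2 - 4) * derivative (derivative P) = C κ * P := by
  have hP' : derivative P ≠ 0 := fun h0 => by
    rw [derivative_eq_zero] at h0; omega
  have h4 : derivative (4 : ℂ[X]) = 0 := derivative_ofNat 4
  have hd := congrArg derivative h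
  simp only [derivative_mul, derivative_sub, derivative_pow, derivative_C, h4, derivative_X] at hd
  apply mul_left_cancel₀ (mul_ne_zero (two_ne_zero (α := ℂ[X])) hP')
  have h2 : (C 2 : ℂ[X]) = 2 := rfl
  simp [h2] at hd
  linear_combination hd

/-- A polynomial of degree `k` solving `(X² - 4) P'² = κ (P² - 4)` is `± T_k`. -/
theorem eq_chebT_of_ode {P : ℂ[X]} {κ : ℂ} (hP : 0 < P.natDegree)
    (h : (X ^ 2 - 4) * derivative P ^ 2 = C κ * (P ^ 2 - 4)) :
    ∃ ε : ℂ, (ε = 1 ∨ ε = -1) ∧ P = C ε * chebT P.natDegree := by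
  set k := P.natDegree with hk
  have hP0 : P ≠ 0 := by rintro rfl; simp [hk] at hP
  have key : ∀ (Q : ℂ[X]) (lam : ℂ), Q ≠ 0 →
      X * derivative Q + (X ^ 2 - 4) * derivative (derivative Q) = C lam * Q →
      lam = (Q.natDegree : ℂ) ^ 2 := by
    intro Q lam hQ hode
    have hc := congrArg (fun p => p.coeff Q.natDegree) hode
    have h4 : (4 : ℂ[X]) = C 4 := rfl
    have hx : (X : ℂ[X]) * derivative Q + (X ^ 2 - 4) * derivative (derivative Q)
      = X * derivative Q + X * (X * derivative (derivative Q))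
        - C 4 * derivative (derivative Q) := by rw [h4]; ring
    rw [hx] at hc
    have hlead : Q.coeff Q.natDegree ≠ 0 := by simpa using hQ
    have hhigh : ∀ j, Q.coeff (Q.natDegree + j + 1) = 0 := fun j =>
      coeff_eq_zero_of_natDegree_lt (by omega)
    simp only [coeff_add, coeff_sub, coeff_C_mul] at hc
    have h2 : (derivative (derivative Q)).coeff Q.natDegree = 0 := by
      rw [coeff_derivative, coeff_derivative, hhigh 1]; simp
    rw [h2] at hc
    apply mul_right_cancel₀ hlead
    rw [← hc]
    rcases Q.natDegree with _ | _ | j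
    · simp
    · simp [coeff_X_mul, coeff_derivative]
    · simp only [coeff_X_mul, coeff_derivative]
      push_cast
      ring
  have hPo := second_order_of_ode hP h
  have hκ : κ = (k : ℂ) ^ 2 := key P κ hP0 hPo
  have hTd : (chebT k).natDegree = k := natDegree_chebT hP
  have hTo := second_order_of_ode (by rw [hTd]; exact hP) (chebT_ode k)
  set p := P.leadingCoeff with hp
  have hp0 : p ≠ 0 := leadingCoeff_ne_zero.mpr hP0
  have hPT : P = C p * chebT k := by
    by_contra hne
    have hD : P - C p * chebT k ≠ 0 := sub_ne_zero.mpr hne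
    have hDo := key (P - C p * chebT k) κ hD (by
      simp only [derivative_sub, derivative_C_mul]
      rw [hκ] at hPo ⊢
      linear_combination hPo - C p * hTo)
    have hlt : (P - C p * chebT k).natDegree < k := by
      have hdeg : (P - C p * chebT k).degree < P.degree := by
        apply degree_sub_lt_left
        · rw [degree_C_mul hp0, degree_eq_natDegree hP0,
            degree_eq_natDegree (chebT_monic hP).ne_zero, hTd]
        · exact hP0
        · rw [leadingCoeff_mul, leadingCoeff_C, (chebT_monic hP).leadingCoeff, mul_one]
      exact natDegree_lt_natDegree hD hdeg
    rw [hκ] at hDo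
    have : (k ^ 2 : ℕ) = (P - C p * chebT k).natDegree ^ 2 := by exact_mod_cast hDo
    have := Nat.pow_left_injective (n := 2) (by norm_num) this
    omega
  refine ⟨p, ?_, hPT⟩
  have hT := chebT_ode k
  rw [hPT, derivative_C_mul, hκ] at h
  have h5 : C ((k : ℂ) ^ 2) * (4 - 4 * C p ^ 2) = 0 := by
    linear_combination h - C p ^ 2 * hT
  have h6 := congrArg (eval 0) h5
  have hk0 : (k : ℂ) ≠ 0 := by exact_mod_cast hP.ne'
  simp [hk0] at h6
  have : (p - 1) * (p + 1) = 0 := by linear_combination -h6/4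
  rcases mul_eq_zero.mp this with h7 | h7
  · exact Or.inl (sub_eq_zero.mp h7)
  · exact Or.inr (eq_neg_of_add_eq_zero_left h7)

/-- If `b` and `d` have coprime degrees, the powers `1, d, …, d ^ (deg b - 1)` are linearly
independent over `ℂ[b]`. -/
theorem eq_zero_of_sum_comp_mul_pow_eq_zero {b d : ℂ[X]} (hb : 0 < b.natDegree)
    (hd : 0 < d.natDegree) (hbd : Nat.Coprime b.natDegree d.natDegree) (g : ℕ → ℂ[X])
    (h : ∑ j ∈ Finset.range b.natDegree, (g j).comp b * d ^ j = 0) :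
    ∀ j < b.natDegree, g j = 0 := by
  have hd0 : d ≠ 0 := by rintro rfl; simp at hd
  have hcomp : ∀ p : ℂ[X], p ≠ 0 → p.comp b ≠ 0 := by
    intro p hp h0
    rcases comp_eq_zero_iff.mp h0 with h1 | h1
    · exact hp h1
    · rw [h1.2, natDegree_C] at hb
      exact lt_irrefl _ hb
  have hdeg : ∀ j, g j ≠ 0 → ((g j).comp b * d ^ j).degree =
      (((g j).natDegree * b.natDegree + j * d.natDegree : ℕ) : WithBot ℕ) := by
    intro j hj
    rw [degree_eq_natDegree (mul_ne_zero (hcomp _ hj) (pow_ne_zero _ hd0)),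
      natDegree_mul (hcomp _ hj) (pow_ne_zero _ hd0), natDegree_comp, natDegree_pow]
  have hsum := degree_sum_eq_of_disjoint (fun j => (g j).comp b * d ^ j)
    (Finset.range b.natDegree) (by
      rintro i ⟨hi, hi0⟩ j ⟨hj, hj0⟩ hij heq
      have hgi : g i ≠ 0 := by rintro h0; simp [h0] at hi0
      have hgj : g j ≠ 0 := by rintro h0; simp [h0] at hj0
      simp only [Function.comp_apply, hdeg i hgi, hdeg j hgj] at heq
      have heq' : (g i).natDegree * b.natDegree + i * d.natDegree =
        (g j).natDegree * b.natDegree + j * d.natDegree := by exact_mod_cast heq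
      have hmod : i * d.natDegree ≡ j * d.natDegree [MOD b.natDegree] := by
        have := congrArg (· % b.natDegree) heq'
        simpa [Nat.ModEq, Nat.add_mod] using this
      have hmod' := Nat.ModEq.cancel_right_of_coprime hbd hmod
      exact hij (Nat.ModEq.eq_of_lt_of_lt hmod' (Finset.mem_range.mp hi) (Finset.mem_range.mp hj)))
  rw [h, degree_zero] at hsum
  intro j hj
  by_contra hgj
  have := (Finset.sup_eq_bot_iff _ _).mp hsum.symm j (Finset.mem_range.mpr hj)
  rw [hdeg j hgj] at this
  exact WithBot.coe_ne_bot this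

/-- If `a ∘ b = c ∘ d` with `b, d` of coprime degrees and `deg c = deg b`, then `d` maps the
fibre of `b` over `α` onto the fibre of `c` over `a(α)`, respecting multiplicities. -/
theorem roots_sub_C_eq_map_eval {a b c d : ℂ[X]} (hb : 0 < b.natDegree) (hd : 0 < d.natDegree)
    (hbd : Nat.Coprime b.natDegree d.natDegree) (hcb : c.natDegree = b.natDegree)
    (heq : a.comp b = c.comp d) (α : ℂ) :
    (c - C (a.eval α)).roots = (b - C α).roots.map d.eval := by
  set n := b.natDegree with hn
  set m := d.natDegree with hm
  let f : ℂ[X][X][X] := b.map (C.comp C) - C (C X)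
  let g : ℂ[X][X][X] := d.map (C.comp C) - C X
  set R : ℂ[X][X] := resultant f g n m with hR
  have hφ : ∀ α γ : ℂ, (R.map (evalRingHom α)).eval γ =
      b.leadingCoeff ^ m * ((b - C α).roots.map (fun x => d.eval x - γ)).prod := by
    intro α γ
    let φ : ℂ[X][X] →+* ℂ := (evalRingHom γ).comp (mapRingHom (evalRingHom α))
    have h1 : (R.map (evalRingHom α)).eval γ = φ R := rfl
    have hid : φ.comp (C.comp C) = RingHom.id ℂ := RingHom.ext fun x => by simp [φ]
    have hf : f.map φ = b - C α := by
      simp only [f, Polynomial.map_sub, Polynomial.map_map, map_C, hid, Polynomial.map_id]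
      simp [φ]
    have hg : g.map φ = d - C γ := by
      simp only [g, Polynomial.map_sub, Polynomial.map_map, map_C, hid, Polynomial.map_id]
      simp [φ]
    have hnd : (b - C α).natDegree = n := natDegree_sub_C
    have hlc : (b - C α).leadingCoeff = b.leadingCoeff := by
      rw [leadingCoeff, hnd, coeff_sub, coeff_C, if_neg hb.ne', sub_zero]; rfl
    rw [h1, hR, ← resultant_map_map, hf, hg, ← hnd, resultant_eq_prod_eval _ _ _
      (natDegree_sub_C).le (IsAlgClosed.splits _), hlc]
    simp [hm]
  set μ : ℂ := b.leadingCoeff ^ m * (-1) ^ n with hμ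
  have hμ0 : μ ≠ 0 := by
    have : b ≠ 0 := by rintro rfl; simp [hn] at hb
    simp [hμ, this]
  have hRα : ∀ α : ℂ, R.map (evalRingHom α) =
      C μ * ((b - C α).roots.map (fun x => X - C (d.eval x))).prod := by
    intro α
    apply Polynomial.funext
    intro γ
    have hcard : (b - C α).roots.card = n := by
      rw [IsAlgClosed.card_roots_eq_natDegree, natDegree_sub_C]
    have hneg : ∀ x, d.eval x - γ = -1 * eval γ (X - C (d.eval x)) := fun x => by simp
    rw [hφ, eval_mul, eval_C, eval_multiset_prod, Multiset.map_map, hμ, mul_assoc, ← hcard]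
    simp only [hneg, Multiset.prod_map_mul, Multiset.map_const', Multiset.prod_replicate,
      Function.comp_def]
  have hprodm : ∀ α : ℂ, ((b - C α).roots.map (fun x => X - C (d.eval x))).prod.Monic :=
    fun α => monic_multiset_prod_of_monic _ _ fun x _ => monic_X_sub_C _
  have hprodd : ∀ α : ℂ, ((b - C α).roots.map (fun x => X - C (d.eval x))).prod.natDegree = n := by
    intro α
    rw [natDegree_multiset_prod_of_monic _ (by
      intro p hp
      obtain ⟨x, -, rfl⟩ := Multiset.mem_map.mp hp
      exact monic_X_sub_C _)]
    simp [Multiset.map_map, IsAlgClosed.card_roots_eq_natDegree, hn]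
  have hRn : R.coeff n = C μ := by
    apply Polynomial.funext
    intro α
    have := congrArg (fun p => p.coeff n) (hRα α)
    simp only [coeff_map, coeff_C_mul, coe_evalRingHom] at this
    rw [this, eval_C]
    conv_lhs => rw [← hprodd α]
    rw [(hprodm α).coeff_natDegree, mul_one]
  have hRk : ∀ k, n < k → R.coeff k = 0 := by
    intro k hk
    apply Polynomial.funext
    intro α
    have := congrArg (fun p => p.coeff k) (hRα α)
    simp only [coeff_map, coeff_C_mul, coe_evalRingHom] at this
    rw [this, coeff_eq_zero_of_natDegree_lt (by rw [hprodd]; exact hk)]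
    simp
  set κ : ℂ := μ / c.leadingCoeff with hκ
  have hc0 : c.leadingCoeff ≠ 0 := by
    rw [Ne, leadingCoeff_eq_zero]; rintro rfl; simp at hcb; omega
  set G : ℂ[X][X] := R - C (C κ) * (c.map C - C a) with hG
  have hGk : ∀ k, n ≤ k → G.coeff k = 0 := by
    intro k hk
    have hk0 : k ≠ 0 := by omega
    rw [hG, coeff_sub, coeff_C_mul, coeff_sub, coeff_map, coeff_C, if_neg hk0, sub_zero]
    rcases hk.eq_or_lt with rfl | hlt
    · rw [hRn, ← C_mul, ← C_sub]
      have : c.coeff n = c.leadingCoeff := by rw [leadingCoeff, hcb]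
      rw [this, hκ, div_mul_cancel₀ _ hc0, sub_self, C_0]
    · rw [hRk k hlt, coeff_eq_zero_of_natDegree_lt (by rw [hcb]; exact hlt)]
      simp
  have hGeval : ∀ α γ : ℂ, (G.map (evalRingHom α)).eval γ =
      b.leadingCoeff ^ m * ((b - C α).roots.map (fun x => d.eval x - γ)).prod
        - κ * (c.eval γ - a.eval α) := by
    intro α γ
    rw [hG, Polynomial.map_sub, eval_sub, hφ]
    simp only [Polynomial.map_mul, map_C, Polynomial.map_sub, Polynomial.map_map, eval_mul,
      eval_sub, eval_C, coe_evalRingHom]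
    congr 3
    have : (evalRingHom α).comp C = RingHom.id ℂ := by ext x; simp
    rw [this, Polynomial.map_id]
  have hGdeg : G.natDegree < n := by
    have : G.natDegree ≤ n - 1 := natDegree_le_iff_coeff_eq_zero.mpr fun k hk => hGk k (by omega)
    omega
  have hG0 : G = 0 := by
    have key := eq_zero_of_sum_comp_mul_pow_eq_zero hb hd hbd (fun j => G.coeff j) (by
      apply Polynomial.funext
      intro t
      have h1 := hGeval (b.eval t) (d.eval t)
      have hmem : t ∈ (b - C (b.eval t)).roots := by
        rw [mem_roots (fun h0 => hb.ne' (by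
          rw [hn, sub_eq_zero.mp h0, natDegree_C]))]
        simp
      have hz : ((b - C (b.eval t)).roots.map (fun x => d.eval x - d.eval t)).prod = 0 :=
        Multiset.prod_eq_zero (Multiset.mem_map.mpr ⟨t, hmem, sub_self _⟩)
      have hac : c.eval (d.eval t) = a.eval (b.eval t) := by
        rw [← eval_comp, ← eval_comp, heq]
      rw [hz, hac, sub_self, mul_zero, mul_zero, sub_zero, eval_eq_sum_range'
        (lt_of_le_of_lt natDegree_map_le hGdeg)] at h1
      rw [eval_finsetSum, eval_zero, ← h1]
      simp [eval_comp, hn])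
    ext1 k
    rcases lt_or_ge k n with hk | hk
    · exact key k hk
    · exact hGk k hk
  have hfin : C κ * (c - C (a.eval α)) =
      C μ * ((b - C α).roots.map (fun x => X - C (d.eval x))).prod := by
    rw [← hRα]
    apply Polynomial.funext
    intro γ
    have := hGeval α γ
    rw [hG0, Polynomial.map_zero, eval_zero, ← hφ] at this
    simp only [eval_mul, eval_C, eval_sub]
    exact (sub_eq_zero.mp this.symm).symm
  have hκ0 : κ ≠ 0 := div_ne_zero hμ0 hc0
  rw [← roots_C_mul _ hκ0, hfin, roots_C_mul _ hμ0]
  have := roots_multiset_prod_X_sub_C ((b - C α).roots.map d.eval)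
  rwa [Multiset.map_map] at this

/-- The ramification index of `p` at `x`. -/
noncomputable def ramIdx (p : ℂ[X]) (x : ℂ) : ℕ :=
  (p - C (p.eval x)).rootMultiplicity x

theorem sub_C_ne_zero {p : ℂ[X]} (hp : 0 < p.natDegree) (u : ℂ) : p - C u ≠ 0 := fun h => by
  rw [sub_eq_zero.mp h, natDegree_C] at hp
  exact lt_irrefl _ hp

theorem derivative_ne_zero {p : ℂ[X]} (hp : 0 < p.natDegree) : derivative p ≠ 0 := fun h => by
  rw [derivative_eq_zero] at h; omega

theorem mem_roots_sub_C_iff {p : ℂ[X]} (hp : 0 < p.natDegree) {u x : ℂ} :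
    x ∈ (p - C u).roots ↔ p.eval x = u := by
  rw [mem_roots (sub_C_ne_zero hp u), IsRoot, eval_sub, eval_C, sub_eq_zero]

theorem ramIdx_eq_rootMultiplicity {p : ℂ[X]} {x u : ℂ} (h : p.eval x = u) :
    ramIdx p x = (p - C u).rootMultiplicity x := by rw [ramIdx, h]

theorem ramIdx_pos {p : ℂ[X]} (hp : 0 < p.natDegree) (x : ℂ) : 0 < ramIdx p x :=
  (rootMultiplicity_pos (sub_C_ne_zero hp _)).mpr (by simp)

theorem rootMultiplicity_derivative {p : ℂ[X]} (x : ℂ) :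
    (derivative p).rootMultiplicity x = ramIdx p x - 1 := by
  have := derivative_rootMultiplicity_of_root (p := p - C (p.eval x)) (t := x) (by simp)
  simpa [ramIdx] using this

theorem two_le_ramIdx_iff {p : ℂ[X]} (hp : 0 < p.natDegree) {x : ℂ} :
    2 ≤ ramIdx p x ↔ (derivative p).eval x = 0 := by
  have h := rootMultiplicity_pos (derivative_ne_zero hp) (x := x)
  rw [rootMultiplicity_derivative, IsRoot] at h
  rw [← h]
  omega

theorem ramIdx_comp {p q : ℂ[X]} (hp : 0 < p.natDegree) (hq : 0 < q.natDegree) (x : ℂ) :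
    ramIdx (p.comp q) x = ramIdx p (q.eval x) * ramIdx q x := by
  obtain ⟨g, hg, hgd⟩ := exists_eq_pow_rootMultiplicity_mul_and_not_dvd
    (p - C (p.eval (q.eval x))) (sub_C_ne_zero hp _) (q.eval x)
  have hgx : ¬ (g.comp q).IsRoot x := by
    rw [IsRoot, eval_comp]
    exact fun h => hgd (dvd_iff_isRoot.mpr h)
  have hg0 : g.comp q ≠ 0 := by rintro h; simp [h] at hgx
  have h := congrArg (fun r => r.comp q) hg
  simp only [sub_comp, C_comp, mul_comp, pow_comp, X_comp] at h
  rw [ramIdx, eval_comp, h, rootMultiplicity_mul (mul_ne_zero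
    (pow_ne_zero _ (sub_C_ne_zero hq _)) hg0), rootMultiplicity_eq_zero hgx, add_zero,
    ← count_roots, roots_pow, Multiset.count_nsmul, count_roots]
  rfl

/-- A solution of `a ∘ b = c ∘ d` in which the degrees of `a` and `b` are coprime and the two
decompositions have interchanged degrees. -/
structure RittSquare (a b c d : ℂ[X]) : Prop where
  comp_eq : a.comp b = c.comp d
  pos_left : 0 < a.natDegree
  pos_right : 0 < b.natDegree
  natDegree_c : c.natDegree = b.natDegree
  natDegree_d : d.natDegree = a.natDegree
  coprime : Nat.Coprime a.natDegree b.natDegree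

namespace RittSquare

variable {a b c d : ℂ[X]}

theorem of_gcd (ha : 0 < a.natDegree) (hb : 0 < b.natDegree) (heq : a.comp b = c.comp d)
    (hac : Nat.gcd a.natDegree c.natDegree = 1) (hbd : Nat.gcd b.natDegree d.natDegree = 1) :
    RittSquare a b c d := by
  have h := congrArg natDegree heq
  rw [natDegree_comp, natDegree_comp] at h
  have h1 : a.natDegree ∣ d.natDegree :=
    Nat.Coprime.dvd_of_dvd_mul_left hac (h ▸ Dvd.intro _ rfl)
  have h2 : d.natDegree ∣ a.natDegree :=
    Nat.Coprime.dvd_of_dvd_mul_right (Nat.Coprime.symm hbd) (h ▸ Dvd.intro_left _ rfl)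
  have hd : d.natDegree = a.natDegree := Nat.dvd_antisymm h2 h1
  rw [hd, mul_comm] at h
  exact ⟨heq, ha, hb, (Nat.eq_of_mul_eq_mul_right ha h).symm, hd,
    Nat.Coprime.symm (hd ▸ hbd)⟩

theorem symm (h : RittSquare a b c d) : RittSquare c d a b where
  comp_eq := h.comp_eq.symm
  pos_left := h.natDegree_c ▸ h.pos_right
  pos_right := h.natDegree_d ▸ h.pos_left
  natDegree_c := h.natDegree_d.symm
  natDegree_d := h.natDegree_c.symm
  coprime := by rw [h.natDegree_c, h.natDegree_d]; exact h.coprime.symm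

theorem eval_eq (h : RittSquare a b c d) (x : ℂ) : a.eval (b.eval x) = c.eval (d.eval x) := by
  rw [← eval_comp, ← eval_comp, h.comp_eq]

theorem roots_eq (h : RittSquare a b c d) (α : ℂ) :
    (c - C (a.eval α)).roots = (b - C α).roots.map d.eval :=
  roots_sub_C_eq_map_eval h.pos_right h.symm.pos_right (h.natDegree_d ▸ h.coprime.symm)
    h.natDegree_c h.comp_eq α

theorem exists_common (h : RittSquare a b c d) {α γ : ℂ} (hαγ : a.eval α = c.eval γ) :
    ∃ x, b.eval x = α ∧ d.eval x = γ := by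
  have hm : γ ∈ (c - C (a.eval α)).roots := (mem_roots_sub_C_iff h.symm.pos_left).mpr hαγ.symm
  rw [h.roots_eq] at hm
  obtain ⟨x, hx, hdx⟩ := Multiset.mem_map.mp hm
  exact ⟨x, (mem_roots_sub_C_iff h.pos_right).mp hx, hdx⟩

theorem ramIdx_mul (h : RittSquare a b c d) (x : ℂ) :
    ramIdx a (b.eval x) * ramIdx b x = ramIdx c (d.eval x) * ramIdx d x := by
  rw [← ramIdx_comp h.pos_left h.pos_right, ← ramIdx_comp h.symm.pos_left h.symm.pos_right,
    h.comp_eq]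

theorem ramIdx_le (h : RittSquare a b c d) (x : ℂ) : ramIdx b x ≤ ramIdx c (d.eval x) := by
  rw [ramIdx_eq_rootMultiplicity (h.eval_eq x).symm, ramIdx, ← count_roots, ← count_roots,
    h.roots_eq]
  rw [Multiset.le_count_iff_replicate_le, ← Multiset.map_replicate (f := fun y => d.eval y)]
  exact Multiset.map_le_map (Multiset.le_count_iff_replicate_le.mp le_rfl)

theorem eq_of_eval_eq (h : RittSquare a b c d) {x y : ℂ} (hb : b.eval x = b.eval y)
    (hd : d.eval x = d.eval y) (hc : (derivative c).eval (d.eval x) ≠ 0) : x = y := by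
  by_contra hxy
  have hle : ({x, y} : Multiset ℂ) ≤ (b - C (b.eval x)).roots := by
    rw [Multiset.le_iff_subset (by simpa using hxy)]
    intro z hz
    rw [mem_roots_sub_C_iff h.pos_right]
    rcases (by simpa using hz : z = x ∨ z = y) with rfl | rfl
    · rfl
    · exact hb.symm
  have hle' := Multiset.count_le_of_le (d.eval x) (Multiset.map_le_map hle (f := d.eval))
  rw [← h.roots_eq, count_roots, ← ramIdx_eq_rootMultiplicity (h.eval_eq x).symm] at hle'
  refine hc ((two_le_ramIdx_iff h.symm.pos_left).mp (le_trans ?_ hle'))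
  simp [← hd]

end RittSquare

theorem eq_of_comp_eq_comp {p q r : ℂ[X]} (hr : 0 < r.natDegree) (h : p.comp r = q.comp r) :
    p = q := by
  have h0 : (p - q).comp r = 0 := by rw [sub_comp, h, sub_self]
  rcases comp_eq_zero_iff.mp h0 with h1 | h1
  · exact sub_eq_zero.mp h1
  · rw [h1.2, natDegree_C] at hr
    exact absurd hr (lt_irrefl _)

theorem exists_odd_rootMultiplicity {P : ℂ[X]} (hP : Odd P.natDegree) :
    ∃ x, Odd (P.rootMultiplicity x) := by
  by_contra! hx
  refine Nat.not_even_iff_odd.mpr hP ?_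
  rw [← IsAlgClosed.card_roots_eq_natDegree, ← Multiset.toFinset_sum_count_eq]
  refine Finset.even_sum _ fun x _ => ?_
  rw [count_roots]
  exact Nat.not_odd_iff_even.mp (hx x)

theorem exists_ode_of_ramified_aux {P : ℂ[X]} (hP : 0 < P.natDegree) {u v s t : ℂ} (huv : u ≠ v)
    (h : ∀ x, P.eval x = u ∨ P.eval x = v → (derivative P).eval x = 0 ∨ x = s ∨ x = t) :
    ∃ κ : ℂ, κ ≠ 0 ∧
      (X - C s) * (X - C t) * derivative P ^ 2 = C κ * ((P - C u) * (P - C v)) := by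
  have hu := sub_C_ne_zero hP u
  have hv := sub_C_ne_zero hP v
  have hP' := derivative_ne_zero hP
  have hs := X_sub_C_ne_zero s
  have ht := X_sub_C_ne_zero t
  have hR : (P - C u) * (P - C v) ≠ 0 := mul_ne_zero hu hv
  have hL : (X - C s) * (X - C t) * derivative P ^ 2 ≠ 0 :=
    mul_ne_zero (mul_ne_zero hs ht) (pow_ne_zero 2 hP')
  have hdvd : (P - C u) * (P - C v) ∣ (X - C s) * (X - C t) * derivative P ^ 2 := by
    rw [IsAlgClosed.dvd_iff_roots_le_roots hR hL, Multiset.le_iff_count]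
    intro x
    rw [roots_mul hR, roots_mul hL, roots_mul (mul_ne_zero hs ht), roots_pow, roots_X_sub_C,
      roots_X_sub_C]
    simp only [Multiset.count_add, Multiset.count_nsmul, count_roots, rootMultiplicity_derivative,
      Multiset.count_singleton]
    have hcase : ∀ w w' : ℂ, w ≠ w' → P.eval x = w →
        (P - C w).rootMultiplicity x + (P - C w').rootMultiplicity x = ramIdx P x := by
      intro w w' hw hx
      rw [← ramIdx_eq_rootMultiplicity hx, rootMultiplicity_eq_zero, add_zero]
      simpa [hx, sub_eq_zero] using hw
    have key : P.eval x = u ∨ P.eval x = v →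
        ramIdx P x ≤ (if x = s then 1 else 0) + (if x = t then 1 else 0) + 2 * (ramIdx P x - 1) := by
      intro hx
      have h1 := ramIdx_pos hP x
      rcases h x hx with h2 | h2 | h2
      · have := (two_le_ramIdx_iff hP).mpr h2
        omega
      · rw [if_pos h2]; omega
      · rw [if_pos h2]; omega
    by_cases hxu : P.eval x = u
    · rw [hcase u v huv hxu]
      exact key (Or.inl hxu)
    by_cases hxv : P.eval x = v
    · rw [add_comm (rootMultiplicity x (P - C u)), hcase v u huv.symm hxv]
      exact key (Or.inr hxv)
    rw [rootMultiplicity_eq_zero (by simpa [sub_eq_zero] using hxu),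
      rootMultiplicity_eq_zero (by simpa [sub_eq_zero] using hxv)]
    omega
  obtain ⟨q, hq⟩ := hdvd
  have hq0 : q ≠ 0 := by rintro rfl; exact hL (by rw [hq, mul_zero])
  have hdeg := congrArg natDegree hq
  rw [natDegree_mul (mul_ne_zero hs ht) (pow_ne_zero 2 hP'), natDegree_mul hs ht,
    natDegree_mul hR hq0, natDegree_mul hu hv, natDegree_pow, natDegree_X_sub_C,
    natDegree_X_sub_C, natDegree_sub_C, natDegree_sub_C, natDegree_derivative] at hdeg
  have hqd : q.natDegree = 0 := by omega
  obtain ⟨κ, rfl⟩ := natDegree_eq_zero.mp hqd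
  exact ⟨κ, by rintro rfl; simp at hq0, by rw [hq, mul_comm]⟩

/-- If `P` is ramified over `u` and `v` away from the points `s` and `t`, then `s ≠ t` and `P`
satisfies a Chebyshev-type differential equation. -/
theorem exists_ode_of_ramified {P : ℂ[X]} (hP : 0 < P.natDegree) {u v s t : ℂ} (huv : u ≠ v)
    (h : ∀ x, P.eval x = u ∨ P.eval x = v → (derivative P).eval x = 0 ∨ x = s ∨ x = t) :
    s ≠ t ∧ ∃ κ : ℂ, κ ≠ 0 ∧
      (X - C s) * (X - C t) * derivative P ^ 2 = C κ * ((P - C u) * (P - C v)) := by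
  refine ⟨?_, exists_ode_of_ramified_aux hP huv h⟩
  rintro rfl
  have hR : (P - C u) * (P - C v) ≠ 0 := mul_ne_zero (sub_C_ne_zero hP u) (sub_C_ne_zero hP v)
  obtain ⟨y, hy⟩ : ∃ y, ((P - C u) * (P - C v)).eval y ≠ 0 := by
    by_contra! h0
    exact hR (Polynomial.funext (by simpa using h0))
  obtain ⟨κ, hκ, heq⟩ := exists_ode_of_ramified_aux hP (s := s) (t := y) huv
    (fun x hx => (h x hx).imp_right fun h' => Or.inl (h'.elim id id))
  have := congrArg (eval y) heq
  rw [eval_mul, eval_mul, eval_mul, eval_C] at this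
  simp [hκ] at this
  simp [this] at hy

/-- The linear polynomial sending `s` to `2` and `t` to `-2`. -/
noncomputable def lin (s t : ℂ) : ℂ[X] := C (4 / (s - t)) * (X - C s) + C 2

/-- The inverse of `lin s t`. -/
noncomputable def linInv (s t : ℂ) : ℂ[X] := C ((s - t) / 4) * (X - C 2) + C s

theorem lin_comp_linInv {s t : ℂ} (h : s ≠ t) : (lin s t).comp (linInv s t) = X := by
  have h' := sub_ne_zero.mpr h
  simp only [lin, linInv, add_comp, mul_comp, sub_comp, C_comp, X_comp]
  rw [add_sub_cancel_right, ← mul_assoc, ← C_mul, div_mul_div_cancel₀ h', div_self (by norm_num)]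
  simp

theorem linInv_comp_lin {s t : ℂ} (h : s ≠ t) : (linInv s t).comp (lin s t) = X := by
  have h' := sub_ne_zero.mpr h
  simp only [lin, linInv, add_comp, mul_comp, sub_comp, C_comp, X_comp]
  rw [add_sub_cancel_right, ← mul_assoc, ← C_mul, div_mul_div_cancel₀ (by norm_num), div_self h']
  simp

theorem natDegree_lin {s t : ℂ} (h : s ≠ t) : (lin s t).natDegree = 1 := by
  have := congrArg natDegree (lin_comp_linInv h)
  rw [natDegree_comp, natDegree_X] at this
  exact Nat.eq_one_of_mul_eq_one_right this

theorem natDegree_linInv {s t : ℂ} (h : s ≠ t) : (linInv s t).natDegree = 1 := by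
  have := congrArg natDegree (lin_comp_linInv h)
  rw [natDegree_comp, natDegree_X] at this
  exact Nat.eq_one_of_mul_eq_one_left this

theorem lin_comp_eq_of_ode {P : ℂ[X]} (hP : 0 < P.natDegree) {u v s t κ : ℂ} (huv : u ≠ v)
    (hst : s ≠ t)
    (h : (X - C s) * (X - C t) * derivative P ^ 2 = C κ * ((P - C u) * (P - C v))) :
    ∃ ε : ℂ, (ε = 1 ∨ ε = -1) ∧
      (lin u v).comp P = C ε * (chebT P.natDegree).comp (lin s t) := by
  have huv' := sub_ne_zero.mpr huv
  set Q := ((lin u v).comp P).comp (linInv s t) with hQ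
  have hQd : Q.natDegree = P.natDegree := by
    rw [hQ, natDegree_comp, natDegree_comp, natDegree_lin huv, natDegree_linInv hst, one_mul,
      mul_one]
  set l : ℂ := 4 / (u - v) with hl
  set r : ℂ := (s - t) / 4 with hr
  have hJ : linInv s t = C r * (X - C 2) + C s := rfl
  set J := linInv s t
  have hQe : Q = C l * (P.comp J - C u) + C 2 := by
    simp [hQ, lin, hl]
  have hQ' : derivative Q = C l * (C r * (derivative P).comp J) := by
    have hJ' : derivative J = C r := by rw [hJ]; simp
    rw [hQe]
    simp only [derivative_add, derivative_sub, derivative_C_mul, derivative_C, derivative_comp,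
      hJ']
    ring
  have hc := congrArg (fun p => p.comp J) h
  simp only [mul_comp, sub_comp, X_comp, C_comp, pow_comp] at hc
  have e1 : J - C s = C r * (X - C 2) := by rw [hJ]; ring
  have e2 : J - C t = C r * (X + C 2) := by
    have : C s = C t + C r * C 4 := by
      rw [← C_mul, ← C_add, hr]; congr 1; ring
    have h4 : (C 4 : ℂ[X]) = 2 * C 2 := by
      rw [← map_ofNat C 2, ← C_mul]; norm_num
    rw [hJ, this, h4]; ring
  have e3 : C l * (P.comp J - C v) = C l * (P.comp J - C u) + C 4 := by
    have : C l * C u = C l * C v + C 4 := by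
      rw [← C_mul, ← C_mul, ← C_add]
      congr 1
      rw [hl]; field_simp; ring
    linear_combination this
  rw [e1, e2] at hc
  have hode : (X ^ 2 - 4) * derivative Q ^ 2 = C κ * (Q ^ 2 - 4) := by
    have h2 : (C 2 : ℂ[X]) = 2 := rfl
    have h4 : (C 4 : ℂ[X]) = 4 := rfl
    rw [hQ', hQe]
    rw [h2] at hc ⊢
    rw [h4] at e3
    linear_combination C l ^ 2 * hc + C κ * C l * (P.comp J - C u) * e3
  obtain ⟨ε, hε, hQc⟩ := eq_chebT_of_ode (by rw [hQd]; exact hP) hode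
  refine ⟨ε, hε, ?_⟩
  rw [hQd] at hQc
  have := congrArg (fun p => p.comp (lin s t)) hQc
  simpa only [hQ, comp_assoc, linInv_comp_lin hst, comp_X, mul_comp, C_comp, J] using this

/-- In two decompositions with right factors of equal degree, the right factors differ by a
linear polynomial. -/
theorem exists_linear_of_comp_eq_comp {A b A' b' : ℂ[X]} (hA : 0 < A.natDegree)
    (hb : 0 < b.natDegree) (hbb : b'.natDegree = b.natDegree) (h : A.comp b = A'.comp b') :
    ∃ p q : ℂ, p ≠ 0 ∧ b' = C p * b + C q := by
  set k := b.natDegree with hk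
  set N := A.natDegree with hN
  have hb0 : b.leadingCoeff ≠ 0 := leadingCoeff_ne_zero.mpr (by rintro rfl; simp [hk] at hb)
  have hb0' : b'.leadingCoeff ≠ 0 := leadingCoeff_ne_zero.mpr (by
    rintro rfl; simp at hbb; omega)
  have hA' : A'.natDegree = N := by
    have := congrArg natDegree h
    rw [natDegree_comp, natDegree_comp, hbb] at this
    exact (Nat.eq_of_mul_eq_mul_right hb this).symm
  have hA0' : A'.leadingCoeff ≠ 0 := leadingCoeff_ne_zero.mpr (by
    rintro rfl; simp at hA'; omega)
  set p := b'.leadingCoeff / b.leadingCoeff with hp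
  have hp0 : p ≠ 0 := div_ne_zero hb0' hb0
  have hlead : A.leadingCoeff = A'.leadingCoeff * p ^ N := by
    have := congrArg leadingCoeff h
    rw [leadingCoeff_comp (by omega), leadingCoeff_comp (by omega), hA', ← hN] at this
    rw [hp, div_pow, ← mul_div_assoc, ← this, mul_div_cancel_right₀ _ (pow_ne_zero _ hb0)]
  have herase : ∀ B r : ℂ[X], B.natDegree = N → r.natDegree = k →
      (B.comp r - C B.leadingCoeff * r ^ N).natDegree ≤ (N - 1) * k := by
    intro B r hB hr
    have : B.comp r - C B.leadingCoeff * r ^ N = B.eraseLead.comp r := by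
      have h := congrArg (fun p => p.comp r) B.eraseLead_add_C_mul_X_pow
      simp only [add_comp, mul_comp, C_comp, X_pow_comp, hB] at h
      rw [← h, add_sub_cancel_right]
    rw [this, natDegree_comp, hr]
    exact Nat.mul_le_mul_right _ (hB ▸ B.eraseLead_natDegree_le)
  set S := ∑ i ∈ Finset.range N, b' ^ i * (C p * b) ^ (N - 1 - i) with hS
  have hgeom : S * (b' - C p * b) = b' ^ N - (C p * b) ^ N := by
    rw [hS, (Commute.all _ _).geom_sum₂_mul]
  have hpb : (C p * b).natDegree = k := natDegree_C_mul hp0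
  have hpbl : (C p * b).leadingCoeff = b'.leadingCoeff := by
    rw [leadingCoeff_mul, leadingCoeff_C, hp, div_mul_cancel₀ _ hb0]
  have hScoeff : S.coeff ((N - 1) * k) = N * b'.leadingCoeff ^ (N - 1) := by
    rw [hS, finsetSum_coeff]
    have : ∀ i ∈ Finset.range N, (b' ^ i * (C p * b) ^ (N - 1 - i)).coeff ((N - 1) * k) =
        b'.leadingCoeff ^ (N - 1) := by
      intro i hi
      have hi' := Finset.mem_range.mp hi
      have hd : (b' ^ i * (C p * b) ^ (N - 1 - i)).natDegree = (N - 1) * k := by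
        have hbne : b' ≠ 0 := leadingCoeff_ne_zero.mp hb0'
        have hpne : C p * b ≠ 0 := leadingCoeff_ne_zero.mp (hpbl ▸ hb0')
        rw [natDegree_mul (pow_ne_zero _ hbne) (pow_ne_zero _ hpne), natDegree_pow, natDegree_pow,
          hpb, hbb, ← add_mul]
        congr 1; omega
      rw [← hd, coeff_natDegree, leadingCoeff_mul, leadingCoeff_pow, leadingCoeff_pow, hpbl,
        ← pow_add]
      congr 1; omega
    rw [Finset.sum_congr rfl this]
    simp
  have hScoeff0 : S.coeff ((N - 1) * k) ≠ 0 := by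
    rw [hScoeff]
    exact mul_ne_zero (by exact_mod_cast hA.ne') (pow_ne_zero _ hb0')
  have hSd : (N - 1) * k ≤ S.natDegree := le_natDegree_of_ne_zero hScoeff0
  have hS0 : S ≠ 0 := by rintro h0; simp [h0] at hScoeff0
  have hdeg0 : (b' - C p * b).natDegree = 0 := by
    by_cases hD : b' - C p * b = 0
    · rw [hD, natDegree_zero]
    have h1 : C A'.leadingCoeff * (S * (b' - C p * b)) =
        (A.comp b - C A.leadingCoeff * b ^ N) - (A'.comp b' - C A'.leadingCoeff * b' ^ N) := by
      rw [hgeom, hlead, h, mul_pow, C_mul, C_pow]; ring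
    have h2 := natDegree_sub_le_of_le (herase A b rfl rfl) (herase A' b' hA' hbb)
    rw [← h1, natDegree_C_mul hA0', natDegree_mul hS0 hD, max_self] at h2
    omega
  obtain ⟨q, hq⟩ := natDegree_eq_zero.mp hdeg0
  exact ⟨p, q, hp0, by rw [hq]; ring⟩

section Chebyshev

variable {n : ℕ} {γ : ℂ}

theorem chebT_ode_eval (n : ℕ) (γ : ℂ) :
    (γ ^ 2 - 4) * (derivative (chebT n)).eval γ ^ 2 = n ^ 2 * ((chebT n).eval γ ^ 2 - 4) := by
  have h4 : (4 : ℂ[X]) = C 4 := rfl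
  have := congrArg (eval γ) (chebT_ode n)
  rw [h4] at this
  simpa using this

theorem chebT_second_order_eval (hn : 0 < n) (γ : ℂ) :
    γ * (derivative (chebT n)).eval γ +
      (γ ^ 2 - 4) * (derivative (derivative (chebT n))).eval γ = n ^ 2 * (chebT n).eval γ := by
  have h4 : (4 : ℂ[X]) = C 4 := rfl
  have := congrArg (eval γ) (second_order_of_ode (by rwa [natDegree_chebT hn]) (chebT_ode n))
  rw [h4] at this
  simpa using this

theorem sq_sub_four_eq_zero_iff {z : ℂ} : z ^ 2 - 4 = 0 ↔ z = 2 ∨ z = -2 := by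
  have : z ^ 2 - 4 = (z - 2) * (z - -2) := by ring
  rw [this, mul_eq_zero, sub_eq_zero, sub_eq_zero]

theorem chebT_eval_of_derivative_eq_zero (hn : 0 < n) (h : (derivative (chebT n)).eval γ = 0) :
    (chebT n).eval γ = 2 ∨ (chebT n).eval γ = -2 := by
  have h1 := chebT_ode_eval n γ
  rw [h] at h1
  have hn' : (n : ℂ) ≠ 0 := by exact_mod_cast hn.ne'
  simpa [hn', sq_sub_four_eq_zero_iff] using h1.symm

theorem derivative_chebT_eval_eq_zero (hγ : ¬ (γ = 2 ∨ γ = -2))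
    (h : (chebT n).eval γ = 2 ∨ (chebT n).eval γ = -2) : (derivative (chebT n)).eval γ = 0 := by
  have h1 := chebT_ode_eval n γ
  rw [sq_sub_four_eq_zero_iff.mpr h, mul_zero] at h1
  simpa [sq_sub_four_eq_zero_iff, hγ] using h1

theorem derivative_chebT_eval_ne_zero (hn : 0 < n) (hγ : γ = 2 ∨ γ = -2) :
    (derivative (chebT n)).eval γ ≠ 0 := by
  intro h
  have h1 := chebT_second_order_eval hn γ
  have hn' : (n : ℂ) ≠ 0 := by exact_mod_cast hn.ne'
  rw [h, sq_sub_four_eq_zero_iff.mpr hγ] at h1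
  rcases chebT_eval_of_derivative_eq_zero hn h with h2 | h2 <;> simp [h2, hn'] at h1

theorem ramIdx_chebT_of_ne (hn : 0 < n) (hγ : ¬ (γ = 2 ∨ γ = -2))
    (h : (chebT n).eval γ = 2 ∨ (chebT n).eval γ = -2) : ramIdx (chebT n) γ = 2 := by
  have hpos : 0 < (chebT n).natDegree := by rwa [natDegree_chebT hn]
  have h0 := derivative_chebT_eval_eq_zero hγ h
  have h2 : 2 ≤ ramIdx (chebT n) γ := (two_le_ramIdx_iff hpos).mpr h0
  by_contra hne
  have hr : ramIdx (derivative (chebT n)) γ = ramIdx (chebT n) γ - 1 := by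
    rw [ramIdx, h0, C_0, sub_zero, rootMultiplicity_derivative]
  have h3 : (derivative (derivative (chebT n))).rootMultiplicity γ ≠ 0 := by
    rw [rootMultiplicity_derivative, hr]; omega
  have h4 : (derivative (derivative (chebT n))).eval γ = 0 := by
    by_contra h5
    exact h3 (rootMultiplicity_eq_zero h5)
  have h1 := chebT_second_order_eval hn γ
  have hn' : (n : ℂ) ≠ 0 := by exact_mod_cast hn.ne'
  rw [h0, h4] at h1
  rcases h with h | h <;> simp [h, hn'] at h1

theorem ramIdx_chebT_of_eq (hn : 0 < n) (hγ : γ = 2 ∨ γ = -2) : ramIdx (chebT n) γ = 1 := by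
  have hpos : 0 < (chebT n).natDegree := by rwa [natDegree_chebT hn]
  have h1 := ramIdx_pos hpos γ
  have h2 := (two_le_ramIdx_iff hpos).not.mpr (derivative_chebT_eval_ne_zero hn hγ)
  omega

theorem exists_chebT_eval_eq (hn : 2 < n) (u : ℂ) :
    ∃ γ, ¬ (γ = 2 ∨ γ = -2) ∧ (chebT n).eval γ = u := by
  have hn0 : 0 < n := by omega
  have hpos : 0 < (chebT n).natDegree := by rwa [natDegree_chebT hn0]
  by_contra! h
  have hle : (chebT n - C u).roots ≤ {2, -2} := by
    rw [Multiset.le_iff_count]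
    intro x
    by_cases hx : (chebT n).eval x = u
    · have hx2 : x = 2 ∨ x = -2 := by
        by_contra h2
        exact h x (not_or.mp h2) hx
      rw [count_roots, ← ramIdx_eq_rootMultiplicity hx, ramIdx_chebT_of_eq hn0 hx2,
        Multiset.one_le_count_iff_mem]
      simpa using hx2
    · rw [Multiset.count_eq_zero_of_notMem]
      · exact Nat.zero_le _
      · rwa [mem_roots_sub_C_iff hpos]
  have hcard := Multiset.card_le_card hle
  rw [IsAlgClosed.card_roots_eq_natDegree, natDegree_sub_C, natDegree_chebT hn0] at hcard
  simp at hcard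
  omega

theorem chebT_eval_of_eq (n : ℕ) (hγ : γ = 2 ∨ γ = -2) :
    (chebT n).eval γ = 2 ∨ (chebT n).eval γ = -2 := by
  rcases hγ with rfl | rfl
  · exact Or.inl (chebT_eval_two n)
  · rw [chebT_eval_neg_two]
    rcases neg_one_pow_eq_or ℂ n with h | h <;> simp [h]

end Chebyshev

theorem two_ne_neg_two : (2 : ℂ) ≠ -2 := by norm_num

namespace RittSquare

variable {a b d : ℂ[X]} {n : ℕ}

/-- The points of odd ramification of `a` over `±2`, and the two points above them that `d` sends
to `±2`. -/
theorem exists_odd_points (hn : 2 < n) (h : RittSquare a b (chebT n) d) :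
    ∃ α α' s t : ℂ, α ≠ α' ∧ (∀ y, y = α ∨ y = α' →
      (a.eval y = 2 ∨ a.eval y = -2) ∧ Odd (ramIdx a y)) ∧
      ∀ x, b.eval x = α ∨ b.eval x = α' → d.eval x = 2 ∨ d.eval x = -2 → x = s ∨ x = t := by
  have hn0 : 0 < n := by omega
  have huniq : ∀ {x y : ℂ}, b.eval x = b.eval y → d.eval x = d.eval y →
      d.eval x = 2 ∨ d.eval x = -2 → x = y := fun hb hd hx =>
    h.eq_of_eval_eq hb hd (derivative_chebT_eval_ne_zero hn0 hx)
  have hbn : b.natDegree = n := by rw [← h.natDegree_c, natDegree_chebT hn0]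
  rcases Nat.even_or_odd n with hev | hodd
  · have hao : Odd a.natDegree := by
      rw [← Nat.not_even_iff_odd]
      intro hae
      have := Nat.dvd_gcd hae.two_dvd (hbn ▸ hev.two_dvd)
      rw [h.coprime] at this
      omega
    have hTneg : (chebT n).eval (-2) = 2 := by rw [chebT_eval_neg_two, hev.neg_one_pow, mul_one]
    have hex : ∀ u : ℂ, ∃ y, a.eval y = u ∧ Odd (ramIdx a y) := by
      intro u
      obtain ⟨y, hy⟩ := exists_odd_rootMultiplicity (P := a - C u) (by rwa [natDegree_sub_C])
      have hroot : a.eval y = u := by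
        have := (rootMultiplicity_pos (sub_C_ne_zero h.pos_left u)).mp hy.pos
        rwa [IsRoot, eval_sub, eval_C, sub_eq_zero] at this
      exact ⟨y, hroot, by rwa [ramIdx_eq_rootMultiplicity hroot]⟩
    obtain ⟨α, hα, hαo⟩ := hex 2
    obtain ⟨α', hα', hαo'⟩ := hex (-2)
    obtain ⟨s, hs, hs'⟩ := h.exists_common (α := α) (γ := 2) (by rw [hα, chebT_eval_two])
    obtain ⟨t, ht, ht'⟩ := h.exists_common (α := α) (γ := -2) (by rw [hα, hTneg])
    refine ⟨α, α', s, t, ?_, ?_, ?_⟩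
    · rintro rfl
      exact two_ne_neg_two (hα.symm.trans hα')
    · rintro y (rfl | rfl)
      · exact ⟨Or.inl hα, hαo⟩
      · exact ⟨Or.inr hα', hαo'⟩
    · rintro x hx hdx
      have hbx : b.eval x = α := by
        refine hx.resolve_right fun hx' => two_ne_neg_two ?_
        rw [← hα', ← hx', h.eval_eq]
        rcases hdx with hdx | hdx
        · rw [hdx, chebT_eval_two]
        · rw [hdx, hTneg]
      rcases hdx with hdx' | hdx'
      · exact Or.inl (huniq (hbx.trans hs.symm) (hdx'.trans hs'.symm) (Or.inl hdx'))
      · exact Or.inr (huniq (hbx.trans ht.symm) (hdx'.trans ht'.symm) (Or.inr hdx'))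
  · have hT : ∀ γ : ℂ, γ = 2 ∨ γ = -2 → (chebT n).eval γ = γ := by
      rintro γ (rfl | rfl)
      · exact chebT_eval_two n
      · rw [chebT_eval_neg_two, hodd.neg_one_pow]; ring
    have hex : ∀ z : ℂ, ∃ y, (a.eval y = 2 ∨ a.eval y = -2) ∧ Odd (ramIdx a y) ∧ y ≠ z := by
      intro z
      by_contra! hcon
      refine (exists_ode_of_ramified h.pos_left (s := z) (t := z) two_ne_neg_two ?_).1 rfl
      intro x hx
      by_cases hxz : x = z
      · exact Or.inr (Or.inl hxz)
      · left
        rw [← two_le_ramIdx_iff h.pos_left]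
        have h1 := ramIdx_pos h.pos_left x
        have h2 : ¬ ramIdx a x = 1 := fun h1 => hxz (hcon x hx (h1 ▸ odd_one))
        omega
    obtain ⟨α, hα, hαo, -⟩ := hex 0
    obtain ⟨α', hα', hαo', hne⟩ := hex α
    obtain ⟨s, hs, hs'⟩ := h.exists_common (α := α) (γ := a.eval α) (hT _ hα).symm
    obtain ⟨t, ht, ht'⟩ := h.exists_common (α := α') (γ := a.eval α') (hT _ hα').symm
    refine ⟨α, α', s, t, hne.symm, ?_, ?_⟩
    · rintro y (rfl | rfl)
      · exact ⟨hα, hαo⟩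
      · exact ⟨hα', hαo'⟩
    · intro x hx hdx
      have hdx' : d.eval x = a.eval (b.eval x) := by rw [h.eval_eq, hT _ hdx]
      rcases hx with hx | hx
      · exact Or.inl (huniq (hx.trans hs.symm) (by rw [hdx', hs', hx]) hdx)
      · exact Or.inr (huniq (hx.trans ht.symm) (by rw [hdx', ht', hx]) hdx)

theorem exists_ode (hn : 2 < n) (h : RittSquare a b (chebT n) d) :
    ∃ α α' s t κ κ' : ℂ, α ≠ α' ∧ s ≠ t ∧
      (X - C s) * (X - C t) * derivative b ^ 2 = C κ * ((b - C α) * (b - C α')) ∧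
      (X - C s) * (X - C t) * derivative d ^ 2 = C κ' * ((d - C 2) * (d - C (-2))) := by
  have hn0 : 0 < n := by omega
  obtain ⟨α, α', s, t, hne, hα, hst⟩ := h.exists_odd_points hn
  have hb : ∀ x, b.eval x = α ∨ b.eval x = α' → (derivative b).eval x = 0 ∨ x = s ∨ x = t := by
    intro x hx
    by_cases hdx : d.eval x = 2 ∨ d.eval x = -2
    · exact Or.inr (hst x hx hdx)
    · left
      have h1 := h.ramIdx_mul x
      obtain ⟨h2, h3⟩ := hα _ hx
      rw [h.eval_eq] at h2
      rw [ramIdx_chebT_of_ne hn0 hdx h2] at h1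
      rw [← two_le_ramIdx_iff h.pos_right]
      have h4 : Even (ramIdx b x) := by
        have : Even (ramIdx a (b.eval x) * ramIdx b x) := by rw [h1]; exact even_two_mul _
        exact (Nat.even_mul.mp this).resolve_left (Nat.not_even_iff_odd.mpr h3)
      have := ramIdx_pos h.pos_right x
      obtain ⟨k, hk⟩ := h4
      omega
  obtain ⟨hst', κ, hκ, hode⟩ := exists_ode_of_ramified h.pos_right hne hb
  have hd : ∀ x, d.eval x = 2 ∨ d.eval x = -2 → (derivative d).eval x = 0 ∨ x = s ∨ x = t := by
    intro x hx
    by_cases hdx : (derivative d).eval x = 0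
    · exact Or.inl hdx
    right
    have h1 := h.ramIdx_mul x
    have hd1 : ramIdx d x = 1 := by
      have h2 := ramIdx_pos h.symm.pos_right x
      have h3 := (two_le_ramIdx_iff h.symm.pos_right).not.mpr hdx
      omega
    rw [ramIdx_chebT_of_eq hn0 hx, hd1, mul_one] at h1
    have ha1 := Nat.eq_one_of_mul_eq_one_right h1
    obtain ⟨γ, hγ, hTγ⟩ := exists_chebT_eval_eq hn (a.eval (b.eval x))
    obtain ⟨y, hy, hy'⟩ := h.exists_common hTγ.symm
    have h4 := h.ramIdx_mul y
    rw [hy', hy, ha1, one_mul, ramIdx_chebT_of_ne hn0 hγ (by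
      rw [hTγ, h.eval_eq]; exact chebT_eval_of_eq n hx)] at h4
    have h5 : (derivative b).eval y = 0 := by
      rw [← two_le_ramIdx_iff h.pos_right]
      have := ramIdx_pos h.symm.pos_right y
      omega
    have h6 := congrArg (eval y) hode
    simp [h5, hκ, sub_eq_zero, hy] at h6
    exact hst x h6 hx
  obtain ⟨-, κ', -, hode'⟩ := exists_ode_of_ramified h.symm.pos_right two_ne_neg_two hd
  exact ⟨α, α', s, t, κ, κ', hne, hst', hode, hode'⟩

end RittSquare

theorem lin_two_neg_two : lin 2 (-2) = X := by
  have : (4 : ℂ) / (2 - -2) = 1 := by norm_num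
  rw [lin, this]
  simp

theorem C_mul_C_mul_self {ε : ℂ} (hε : ε = 1 ∨ ε = -1) (p : ℂ[X]) : C ε * (C ε * p) = p := by
  rcases hε with rfl | rfl <;> simp

theorem ramIdx_chebT_dvd_two {n : ℕ} (hn : 0 < n) (x : ℂ) : ramIdx (chebT n) x ∣ 2 := by
  have hpos : 0 < (chebT n).natDegree := by rwa [natDegree_chebT hn]
  by_cases hT : (derivative (chebT n)).eval x = 0
  · rw [ramIdx_chebT_of_ne hn (fun hx => derivative_chebT_eval_ne_zero hn hx hT)
      (chebT_eval_of_derivative_eq_zero hn hT)]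
  · have h1 := ramIdx_pos hpos x
    have h2 := (two_le_ramIdx_iff hpos).not.mpr hT
    have : ramIdx (chebT n) x = 1 := by omega
    rw [this]
    exact one_dvd _

/-- A polynomial all of whose critical points lie over `v` is totally ramified over `v`. -/
theorem exists_ramIdx_eq_natDegree {p : ℂ[X]} (hp : 0 < p.natDegree) {v : ℂ}
    (h : ∀ y, (derivative p).eval y = 0 → p.eval y = v) :
    ∃ y, p.eval y = v ∧ ramIdx p y = p.natDegree := by
  have hv := sub_C_ne_zero hp v
  have hp' := derivative_ne_zero hp
  have hdvd : derivative p ∣ p - C v := by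
    rw [IsAlgClosed.dvd_iff_roots_le_roots hp' hv, Multiset.le_iff_count]
    intro y
    rw [count_roots, count_roots]
    by_cases hy : (derivative p).eval y = 0
    · rw [rootMultiplicity_derivative, ramIdx_eq_rootMultiplicity (h y hy)]
      omega
    · rw [rootMultiplicity_eq_zero hy]
      exact Nat.zero_le _
  obtain ⟨q, hq⟩ := hdvd
  have hq0 : q ≠ 0 := by rintro rfl; exact hv (by rw [hq, mul_zero])
  have hqd : q.natDegree = 1 := by
    have := congrArg natDegree hq
    rw [natDegree_mul hp' hq0, natDegree_sub_C, natDegree_derivative] at this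
    omega
  have hroot : ∀ y, p.eval y = v → y ∈ q.roots := by
    intro y hy
    have h1 : (p - C v).rootMultiplicity y =
        (derivative p).rootMultiplicity y + q.rootMultiplicity y := by
      rw [hq, rootMultiplicity_mul (hq ▸ hv)]
    rw [rootMultiplicity_derivative, ← ramIdx_eq_rootMultiplicity hy] at h1
    have h2 := ramIdx_pos hp y
    rw [← Multiset.count_pos, count_roots]
    omega
  obtain ⟨y, hy⟩ : ∃ y, q.roots = {y} :=
    Multiset.card_eq_one.mp (by rw [IsAlgClosed.card_roots_eq_natDegree, hqd])
  have hall : (p - C v).roots = Multiset.replicate p.natDegree y := by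
    rw [Multiset.eq_replicate, IsAlgClosed.card_roots_eq_natDegree, natDegree_sub_C]
    refine ⟨rfl, fun z hz => ?_⟩
    have := hroot z ((mem_roots_sub_C_iff hp).mp hz)
    rwa [hy, Multiset.mem_singleton] at this
  have hyv : p.eval y = v := by
    rw [← mem_roots_sub_C_iff hp, hall, Multiset.mem_replicate]
    exact ⟨hp.ne', rfl⟩
  exact ⟨y, hyv, by rw [ramIdx_eq_rootMultiplicity hyv, ← count_roots, hall,
    Multiset.count_replicate_self]⟩

namespace RittSquare

variable {a b c d : ℂ[X]} {n : ℕ}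

theorem exists_linear_of_left_eq_chebT (hn : 2 < n) (h : RittSquare a b (chebT n) d) :
    ∃ (ℓ ℓhat ℓhatinv : ℂ[X]) (ε : ℂ),
      ℓ.natDegree = 1 ∧ ℓhat.natDegree = 1 ∧ ℓhat.comp ℓhatinv = X ∧ ℓhatinv.comp ℓhat = X ∧
      (ε = 1 ∨ ε = -1) ∧ d = (C ε * chebT d.natDegree).comp ℓ ∧
      a = (C (ε ^ n) * chebT d.natDegree).comp ℓhat ∧ b = ℓhatinv.comp ((chebT n).comp ℓ) := by
  have hbn : b.natDegree = n := by rw [← h.natDegree_c, natDegree_chebT (by omega)]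
  obtain ⟨α, α', s, t, κ, κ', hα, hst, hb, hd⟩ := h.exists_ode hn
  obtain ⟨ε₁, hε₁, hb'⟩ := lin_comp_eq_of_ode h.pos_right hα hst hb
  obtain ⟨ε, hε, hd'⟩ := lin_comp_eq_of_ode h.symm.pos_right two_ne_neg_two hst hd
  rw [lin_two_neg_two, X_comp] at hd'
  rw [hbn] at hb'
  have hlb : (C ε₁ * lin α α').comp b = (chebT n).comp (lin s t) := by
    rw [mul_comp, C_comp, hb', C_mul_C_mul_self hε₁]
  have hinv : (C ε₁ * lin α α').comp ((linInv α α').comp (C ε₁ * X)) = X := by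
    rw [mul_comp, C_comp, ← comp_assoc, lin_comp_linInv hα, X_comp, C_mul_C_mul_self hε₁]
  have hinv' : ((linInv α α').comp (C ε₁ * X)).comp (C ε₁ * lin α α') = X := by
    rw [comp_assoc, mul_comp, C_comp, X_comp, C_mul_C_mul_self hε₁, linInv_comp_lin hα]
  refine ⟨lin s t, C ε₁ * lin α α', (linInv α α').comp (C ε₁ * X), ε, natDegree_lin hst, ?_,
    hinv, hinv', hε, ?_, ?_, ?_⟩
  · rw [natDegree_C_mul (by rcases hε₁ with rfl | rfl <;> norm_num), natDegree_lin hα]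
  · rwa [mul_comp, C_comp]
  · apply eq_of_comp_eq_comp h.pos_right
    rw [comp_assoc, hlb, mul_comp, C_comp, ← comp_assoc, chebT_comp_comm, comp_assoc,
      ← chebT_comp_C_mul hε, ← hd', h.comp_eq]
  · rw [← hlb, ← comp_assoc, hinv', X_comp]

theorem exists_critical_eval_ne (hn : 2 < n) (h : RittSquare a b c (chebT n)) (v : ℂ) :
    ∃ β, (derivative a).eval β = 0 ∧ a.eval β ≠ v := by
  have hn0 : 0 < n := by omega
  have han : a.natDegree = n := by rw [← h.natDegree_d, natDegree_chebT hn0]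
  by_contra! hcon
  obtain ⟨β, hβ, hβn⟩ := exists_ramIdx_eq_natDegree h.pos_left hcon
  have hdvd : n ∣ 2 * c.natDegree := by
    rw [← natDegree_sub_C (a := v), ← IsAlgClosed.card_roots_eq_natDegree,
      ← Multiset.toFinset_sum_count_eq, Finset.mul_sum]
    refine Finset.dvd_sum fun γ hγ => ?_
    rw [Multiset.mem_toFinset, mem_roots_sub_C_iff h.symm.pos_left] at hγ
    obtain ⟨x, hx, hx'⟩ := h.exists_common (hβ.trans hγ.symm)
    have h1 := h.ramIdx_mul x
    rw [hx, hx', hβn, han] at h1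
    rw [count_roots, ← ramIdx_eq_rootMultiplicity hγ, mul_comm]
    exact (Dvd.intro _ h1).trans (Nat.mul_dvd_mul_left _ (ramIdx_chebT_dvd_two hn0 x))
  have hco : Nat.Coprime n c.natDegree := by
    rw [h.natDegree_c, ← han]
    exact h.coprime
  exact absurd (Nat.le_of_dvd two_pos (hco.dvd_of_dvd_mul_right hdvd)) (by omega)

theorem exists_linear_of_right_eq_chebT (hn : 2 < n) (h : RittSquare a b c (chebT n)) :
    ∃ (ℓ ℓhat ℓhatinv : ℂ[X]) (ε : ℂ),
      ℓ.natDegree = 1 ∧ ℓhat.natDegree = 1 ∧ ℓhat.comp ℓhatinv = X ∧ ℓhatinv.comp ℓhat = X ∧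
      (ε = 1 ∨ ε = -1) ∧ a = ℓ.comp ((chebT n).comp ℓhat) ∧
      b = ℓhatinv.comp (C ε * chebT c.natDegree) ∧
      c = ℓ.comp (C (ε ^ n) * chebT c.natDegree) := by
  have hn0 : 0 < n := by omega
  obtain ⟨β, hβ, hβv⟩ := h.exists_critical_eval_ne hn (c.eval 2)
  obtain ⟨x₀, hx₀, hTx₀⟩ := exists_chebT_eval_eq hn 2
  have hβ₀ : (derivative a).eval (b.eval x₀) = 0 := by
    rw [← two_le_ramIdx_iff h.pos_left]
    exact ((two_le_ramIdx_iff h.symm.pos_right).mpr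
      (derivative_chebT_eval_eq_zero hx₀ (Or.inl hTx₀))).trans (h.symm.ramIdx_le x₀)
  have hcrit : ∀ β γ : ℂ, (derivative a).eval β = 0 → a.eval β = c.eval γ →
      (derivative c).eval γ = 0 ∨ γ = 2 ∨ γ = -2 := by
    intro β γ hβ hβγ
    by_cases hγ : γ = 2 ∨ γ = -2
    · exact Or.inr hγ
    left
    obtain ⟨x, hx, hx'⟩ := h.exists_common hβγ
    have h1 := congrArg (eval x) (congrArg derivative h.comp_eq)
    rw [derivative_comp, derivative_comp, eval_mul, eval_mul, eval_comp, eval_comp, hx, hβ,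
      mul_zero, hx'] at h1
    refine (mul_eq_zero.mp h1.symm).resolve_left fun hT => hγ ?_
    exact hx' ▸ chebT_eval_of_derivative_eq_zero hn0 hT
  have hram : ∀ γ, c.eval γ = c.eval 2 ∨ c.eval γ = a.eval β →
      (derivative c).eval γ = 0 ∨ γ = 2 ∨ γ = -2 := by
    rintro γ (hγ | hγ)
    · exact hcrit (b.eval x₀) γ hβ₀ (by rw [h.eval_eq, hTx₀, hγ])
    · exact hcrit β γ hβ hγ.symm
  obtain ⟨-, κ, -, hode⟩ := exists_ode_of_ramified h.symm.pos_left hβv.symm hram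
  obtain ⟨ε, hε, hc'⟩ := lin_comp_eq_of_ode h.symm.pos_left hβv.symm two_ne_neg_two hode
  rw [lin_two_neg_two, comp_X] at hc'
  have hε' : ε ≠ 0 := by rcases hε with rfl | rfl <;> norm_num
  have hlin := hβv.symm
  generalize c.eval 2 = u, a.eval β = v at hlin hc'
  have hA : (C ε * (lin u v).comp a).comp b = (chebT n).comp (chebT c.natDegree) := by
    rw [mul_comp, C_comp, comp_assoc, h.comp_eq, ← comp_assoc, hc', mul_comp, C_comp,
      C_mul_C_mul_self hε, chebT_comp_comm]
  obtain ⟨p, q, hp, hpq⟩ := exists_linear_of_comp_eq_comp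
    (by rw [natDegree_C_mul hε', natDegree_comp, natDegree_lin hlin, one_mul]; exact h.pos_left)
    h.pos_right (by rw [natDegree_chebT h.symm.pos_left, h.natDegree_c]) hA
  have hinv : (C p * X + C q).comp (C p⁻¹ * (X - C q)) = X := by
    simp only [add_comp, mul_comp, C_comp, X_comp]
    rw [← mul_assoc, ← C_mul, mul_inv_cancel₀ hp, C_1, one_mul, sub_add_cancel]
  have hinv' : (C p⁻¹ * (X - C q)).comp (C p * X + C q) = X := by
    simp only [mul_comp, sub_comp, C_comp, X_comp]
    rw [add_sub_cancel_right, ← mul_assoc, ← C_mul, inv_mul_cancel₀ hp, C_1, one_mul]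
  have hpb : chebT c.natDegree = (C p * X + C q).comp b := by
    rw [hpq]; simp
  have hA' : C ε * (lin u v).comp a = (chebT n).comp (C p * X + C q) := by
    apply eq_of_comp_eq_comp h.pos_right
    rw [hA, comp_assoc, ← hpb]
  refine ⟨(linInv u v).comp (C ε * X), C p * X + C q, C p⁻¹ * (X - C q), 1, ?_,
    natDegree_linear hp, hinv, hinv', Or.inl rfl, ?_, ?_, ?_⟩
  · rw [natDegree_comp, natDegree_linInv hlin, natDegree_C_mul_X _ hε']
  · rw [← hA', comp_assoc, mul_comp, C_comp, X_comp, C_mul_C_mul_self hε, ← comp_assoc,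
      linInv_comp_lin hlin, X_comp]
  · rw [C_1, one_mul, hpb, ← comp_assoc, hinv', X_comp]
  · rw [one_pow, C_1, one_mul, comp_assoc, mul_comp, C_comp, X_comp, ← hc', ← comp_assoc,
      linInv_comp_lin hlin, X_comp]

end RittSquare

theorem ritt_moves_with_chebyshev
    (n : ℕ) (hn : 2 < n)
    (a b c d : ℂ[X])
    (ha : 0 < a.natDegree) (hb : 0 < b.natDegree)
    (hc : 0 < c.natDegree) (hd : 0 < d.natDegree)
    (heq : a.comp b = c.comp d)
    (hac : Nat.gcd a.natDegree c.natDegree = 1)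
    (hbd : Nat.gcd b.natDegree d.natDegree = 1) :
    (c = chebT n →
      ∃ (ℓ ℓhat ℓhatinv : ℂ[X]) (ε : ℂ),
        ℓ.natDegree = 1 ∧ ℓhat.natDegree = 1 ∧
        ℓhat.comp ℓhatinv = Polynomial.X ∧ ℓhatinv.comp ℓhat = Polynomial.X ∧
        (ε = 1 ∨ ε = -1) ∧
        d = (Polynomial.C ε * chebT d.natDegree).comp ℓ ∧
        a = (Polynomial.C (ε ^ n) * chebT d.natDegree).comp ℓhat ∧
        b = ℓhatinv.comp ((chebT n).comp ℓ)) ∧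
    (d = chebT n →
      ∃ (ℓ ℓhat ℓhatinv : ℂ[X]) (ε : ℂ),
        ℓ.natDegree = 1 ∧ ℓhat.natDegree = 1 ∧
        ℓhat.comp ℓhatinv = Polynomial.X ∧ ℓhatinv.comp ℓhat = Polynomial.X ∧
        (ε = 1 ∨ ε = -1) ∧
        a = ℓ.comp ((chebT n).comp ℓhat) ∧
        b = ℓhatinv.comp (Polynomial.C ε * chebT c.natDegree) ∧
        c = ℓ.comp (Polynomial.C (ε ^ n) * chebT c.natDegree)) := by
  have h := RittSquare.of_gcd ha hb heq hac hbd
  constructor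
  · rintro rfl
    exact h.exists_linear_of_left_eq_chebT hn
  · rintro rfl
    exact h.exists_linear_of_right_eq_chebT hn
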